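/- arXiv:2208.03350 — 2 statements merged into one kernel-verified Lean document; each statement's English description precedes it below -/
import Mathlib

section
/- Let X : [0,1]×[0,T] → ℝ² and τ : [0,1]×[0,T] → ℝ be smooth, with |X_s(s,t)| = 1 for all (s,t), satisfying ∂_tX = −(I + γ X_s X_sᵀ)(X_sss − τX_s)_s on [0,1]×[0,T] with boundary conditions X_ss = 0 and X_sss − τX_s = 0 at s = 0 and s = 1, where γ > 0 is a constant. Then for every t ∈ [0,T], (1/2) d/dt ∫₀¹ |X_ss|² ds = −∫₀¹ ( |(X_sss − τX_s)_s|² + γ (X_s · (X_sss − τX_s)_s)² ) ds ≤ 0; in particular t ↦ ∫₀¹ |X_ss(s,t)|² ds is nonincreasing. -/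
open Set Real MeasureTheory RealInnerProductSpace

noncomputable section

/-! ### STATEMENT 15 : energy identity -/

abbrev E2 := EuclideanSpace ℝ (Fin 2)

/-- `G = X_sss - τ X_s` at time `t`. -/
def Gop (X : ℝ → ℝ → E2) (τ : ℝ → ℝ → ℝ) (t : ℝ) : ℝ → E2 :=
  fun x => iteratedDeriv 3 (X t) x - τ t x • deriv (X t) x

section helpers

variable {V : Type*} [NormedAddCommGroup V] [NormedSpace ℝ V]

def D1 (F : ℝ × ℝ → V) : ℝ × ℝ → V := fun p => fderiv ℝ F p (1, 0)
def D2 (F : ℝ × ℝ → V) : ℝ × ℝ → V := fun p => fderiv ℝ F p (0, 1)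

lemma D1_smooth {F : ℝ × ℝ → V} (hF : ContDiff ℝ (⊤ : ℕ∞) F) : ContDiff ℝ (⊤ : ℕ∞) (D1 F) :=
  (hF.fderiv_right (m := (⊤ : ℕ∞)) (by simp)).clm_apply contDiff_const

lemma D2_smooth {F : ℝ × ℝ → V} (hF : ContDiff ℝ (⊤ : ℕ∞) F) : ContDiff ℝ (⊤ : ℕ∞) (D2 F) :=
  (hF.fderiv_right (m := (⊤ : ℕ∞)) (by simp)).clm_apply contDiff_const

lemma hasD1 {F : ℝ × ℝ → V} (hF : ContDiff ℝ (⊤ : ℕ∞) F) (s t : ℝ) :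
    HasDerivAt (fun x => F (x, t)) (D1 F (s, t)) s := by
  have h := (hF.differentiable (by simp) (s, t)).hasFDerivAt
  exact h.comp_hasDerivAt s ((hasDerivAt_id s).prodMk (hasDerivAt_const s t))

lemma hasD2 {F : ℝ × ℝ → V} (hF : ContDiff ℝ (⊤ : ℕ∞) F) (s t : ℝ) :
    HasDerivAt (fun r => F (s, r)) (D2 F (s, t)) t := by
  have h := (hF.differentiable (by simp) (s, t)).hasFDerivAt
  exact h.comp_hasDerivAt t ((hasDerivAt_const t s).prodMk (hasDerivAt_id t))

lemma D_comm {F : ℝ × ℝ → V} (hF : ContDiff ℝ (⊤ : ℕ∞) F) : D2 (D1 F) = D1 (D2 F) := by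
  funext p
  have hd : DifferentiableAt ℝ (fderiv ℝ F) p :=
    (hF.fderiv_right (m := (⊤ : ℕ∞)) (by simp)).differentiable (by simp) p
  have hs : IsSymmSndFDerivAt ℝ F p :=
    hF.contDiffAt.isSymmSndFDerivAt (by
      simp only [minSmoothness_of_isRCLikeNormedField]
      exact WithTop.coe_le_coe.2 (le_top : (2 : ℕ∞) ≤ ⊤))
  have key : ∀ v w : ℝ × ℝ, fderiv ℝ (fun q => fderiv ℝ F q v) p w = fderiv ℝ (fderiv ℝ F) p w v := by
    intro v w
    rw [fderiv_clm_apply hd (differentiableAt_const v)]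
    simp
  change fderiv ℝ (fun q => fderiv ℝ F q (1, 0)) p (0, 1) =
    fderiv ℝ (fun q => fderiv ℝ F q (0, 1)) p (1, 0)
  rw [key, key]
  exact hs _ _

lemma deriv_integral {F : ℝ × ℝ → ℝ} (hF : ContDiff ℝ (⊤ : ℕ∞) F) (t : ℝ) :
    HasDerivAt (fun r => ∫ s in (0:ℝ)..1, F (s, r)) (∫ s in (0:ℝ)..1, D2 F (s, t)) t := by
  have hc : Continuous (D2 F) := (D2_smooth hF).continuous
  obtain ⟨C, hC⟩ := ((isCompact_Icc (a := (0:ℝ)) (b := 1)).prod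
    (isCompact_Icc (a := t - 1) (b := t + 1))).exists_bound_of_continuousOn hc.continuousOn
  refine (intervalIntegral.hasDerivAt_integral_of_dominated_loc_of_deriv_le
    (F := fun r s => F (s, r)) (F' := fun r s => D2 F (s, r)) (bound := fun _ => C)
    (s := Icc (t - 1) (t + 1)) (Icc_mem_nhds (by linarith) (by linarith)) ?_ ?_ ?_ ?_ ?_ ?_).2
  · refine Filter.Eventually.of_forall fun r => ?_
    exact (hF.continuous.comp (by fun_prop : Continuous fun s : ℝ => (s, r))).aestronglyMeasurable
  · exact (hF.continuous.comp (by fun_prop : Continuous fun s : ℝ => (s, t))).intervalIntegrable _ _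
  · exact (hc.comp (by fun_prop : Continuous fun s : ℝ => (s, t))).aestronglyMeasurable
  · refine Filter.Eventually.of_forall fun s hs r hr => ?_
    rw [uIoc_of_le zero_le_one] at hs
    exact hC (s, r) ⟨⟨hs.1.le, hs.2⟩, hr⟩
  · exact intervalIntegrable_const
  · exact Filter.Eventually.of_forall fun s _ r _ => hasD2 hF s r

end helpers

theorem energy_identity (γ T : ℝ) (hγ : 0 < γ) (hT : 0 < T)
    (X : ℝ → ℝ → E2) (τ : ℝ → ℝ → ℝ)
    (hXsm : ContDiff ℝ (⊤ : ℕ∞) fun p : ℝ × ℝ => X p.2 p.1)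
    (hτsm : ContDiff ℝ (⊤ : ℕ∞) fun p : ℝ × ℝ => τ p.2 p.1)
    (hinext : ∀ t ∈ Icc (0:ℝ) T, ∀ s ∈ Icc (0:ℝ) 1, ‖deriv (X t) s‖ = 1)
    (hPDE : ∀ t ∈ Icc (0:ℝ) T, ∀ s ∈ Icc (0:ℝ) 1,
      deriv (fun r => X r s) t =
        -(deriv (Gop X τ t) s + (γ * ⟪deriv (X t) s, deriv (Gop X τ t) s⟫) • deriv (X t) s))
    (hBC : ∀ t ∈ Icc (0:ℝ) T,
      iteratedDeriv 2 (X t) 0 = 0 ∧ iteratedDeriv 2 (X t) 1 = 0 ∧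
      Gop X τ t 0 = 0 ∧ Gop X τ t 1 = 0) :
    (∀ t ∈ Icc (0:ℝ) T,
      HasDerivAt (fun r => (1/2) * ∫ s in Ioo (0:ℝ) 1, ‖iteratedDeriv 2 (X r) s‖^2)
        (- ∫ s in Ioo (0:ℝ) 1,
            (‖deriv (Gop X τ t) s‖^2 + γ * ⟪deriv (X t) s, deriv (Gop X τ t) s⟫^2)) t ∧
      (- ∫ s in Ioo (0:ℝ) 1,
            (‖deriv (Gop X τ t) s‖^2 + γ * ⟪deriv (X t) s, deriv (Gop X τ t) s⟫^2)) ≤ 0)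
    ∧ AntitoneOn (fun t => ∫ s in Ioo (0:ℝ) 1, ‖iteratedDeriv 2 (X t) s‖^2)
        (Icc (0:ℝ) T) := by
  set F : ℝ × ℝ → E2 := fun p => X p.2 p.1 with hFdef
  set K : ℝ × ℝ → ℝ := fun p => τ p.2 p.1 with hKdef
  have h1 := D1_smooth hXsm
  have h2 := D1_smooth h1
  have h3 := D1_smooth h2
  have e1 : ∀ t, deriv (X t) = fun s => D1 F (s, t) := fun t => funext fun s => (hasD1 hXsm s t).deriv
  have e2 : ∀ t, iteratedDeriv 2 (X t) = fun s => D1 (D1 F) (s, t) := fun t => by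
    rw [iteratedDeriv_succ, iteratedDeriv_one, e1]
    exact funext fun s => (hasD1 h1 s t).deriv
  have e3 : ∀ t, iteratedDeriv 3 (X t) = fun s => D1 (D1 (D1 F)) (s, t) := fun t => by
    rw [iteratedDeriv_succ, e2]
    exact funext fun s => (hasD1 h2 s t).deriv
  set G : ℝ × ℝ → E2 := fun p => D1 (D1 (D1 F)) p - K p • D1 F p with hGdef
  have hG : ContDiff ℝ (⊤ : ℕ∞) G := h3.sub (hτsm.smul h1)
  have eG : ∀ t, Gop X τ t = fun s => G (s, t) := fun t => by
    funext s
    simp only [Gop, e3, e1, hGdef, hKdef]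
  have edG : ∀ t, deriv (Gop X τ t) = fun s => D1 G (s, t) := fun t => by
    rw [eG]
    exact funext fun s => (hasD1 hG s t).deriv
  have et : ∀ s t, deriv (fun r => X r s) t = D2 F (s, t) := fun s t => (hasD2 hXsm s t).deriv
  simp only [e1, e2, edG, et] at hinext hPDE hBC ⊢
  simp only [eG] at hBC
  have hF2 := D2_smooth hXsm
  have hF21 := D1_smooth hF2
  have hF211 := D1_smooth hF21
  -- inextensibility
  have hin : ∀ t ∈ Icc (0:ℝ) T, ∀ s ∈ Icc (0:ℝ) 1, ⟪D1 F (s, t), D1 (D2 F) (s, t)⟫ = 0 := by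
    intro t ht s hs
    have ha := hasD2 h1 s t
    rw [D_comm hXsm] at ha
    have hb := (ha.norm_sq).hasDerivWithinAt (s := Icc (0:ℝ) T)
    have hc : HasDerivWithinAt (fun r => ‖D1 F (s, r)‖ ^ 2) 0 (Icc (0:ℝ) T) t :=
      (hasDerivWithinAt_const t (Icc (0:ℝ) T) (1:ℝ)).congr
        (fun r hr => by rw [hinext r hr s hs]; norm_num) (by rw [hinext t ht s hs]; norm_num)
    have := (uniqueDiffOn_Icc hT t ht).eq_deriv _ hb hc
    linarith
  have hQ : ∀ t ∈ Icc (0:ℝ) T,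
      (∫ s in (0:ℝ)..1, ⟪D1 (D1 F) (s, t), D1 (D1 (D2 F)) (s, t)⟫) =
      - ∫ s in (0:ℝ)..1, (‖D1 G (s, t)‖ ^ 2 + γ * ⟪D1 F (s, t), D1 G (s, t)⟫ ^ 2) := by
    intro t ht
    obtain ⟨b0, b1, g0, g1⟩ := hBC t ht
    have hl : Continuous fun s : ℝ => (s, t) := by fun_prop
    have c1 := h1.continuous.comp hl
    have c2 := h2.continuous.comp hl
    have c3 := h3.continuous.comp hl
    have cG := hG.continuous.comp hl
    have cG1 := (D1_smooth hG).continuous.comp hl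
    have cF2 := hF2.continuous.comp hl
    have cF21 := hF21.continuous.comp hl
    have cF211 := hF211.continuous.comp hl
    simp only [Function.comp_def] at c1 c2 c3 cG cG1 cF2 cF21 cF211
    have hd : ∀ s ∈ uIcc (0:ℝ) 1, HasDerivAt
        (fun s => ⟪D1 (D1 F) (s, t), D1 (D2 F) (s, t)⟫ - ⟪G (s, t), D2 F (s, t)⟫)
        ((⟪D1 (D1 F) (s, t), D1 (D1 (D2 F)) (s, t)⟫ + ⟪D1 (D1 (D1 F)) (s, t), D1 (D2 F) (s, t)⟫)
          - (⟪G (s, t), D1 (D2 F) (s, t)⟫ + ⟪D1 G (s, t), D2 F (s, t)⟫)) s := fun s _ =>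
      ((hasD1 h2 s t).inner ℝ (hasD1 hF21 s t)).sub ((hasD1 hG s t).inner ℝ (hasD1 hF2 s t))
    have hI := intervalIntegral.integral_eq_sub_of_hasDerivAt hd
      (Continuous.intervalIntegrable (by fun_prop) _ _)
    simp only [b0, b1, g0, g1, inner_zero_left, sub_zero] at hI
    rw [eq_neg_iff_add_eq_zero, ← intervalIntegral.integral_add]
    · refine Eq.trans ?_ hI
      refine intervalIntegral.integral_congr fun s hs => ?_
      rw [uIcc_of_le zero_le_one] at hs
      have i0 := hin t ht s hs
      have p := hPDE t ht s hs
      have gg : G (s, t) = D1 (D1 (D1 F)) (s, t) - K (s, t) • D1 F (s, t) := rfl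
      simp only [p, gg]
      rw [inner_sub_left, inner_smul_left, ← p, i0, p, inner_neg_right, inner_add_right,
        inner_smul_right, real_inner_self_eq_norm_sq, real_inner_comm (D1 F (s, t)) (D1 G (s, t))]
      simp
      ring
    · exact Continuous.intervalIntegrable (by fun_prop) _ _
    · exact Continuous.intervalIntegrable (by fun_prop) _ _
  have hconv : ∀ f : ℝ → ℝ, (∫ s in Ioo (0:ℝ) 1, f s) = ∫ s in (0:ℝ)..1, f s := fun f => by
    rw [intervalIntegral.integral_of_le zero_le_one, integral_Ioc_eq_integral_Ioo]
  simp only [hconv]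
  have hder : ∀ t ∈ Icc (0:ℝ) T,
      HasDerivAt (fun r => (1/2) * ∫ s in (0:ℝ)..1, ‖D1 (D1 F) (s, r)‖ ^ 2)
        (- ∫ s in (0:ℝ)..1, (‖D1 G (s, t)‖ ^ 2 + γ * ⟪D1 F (s, t), D1 G (s, t)⟫ ^ 2)) t := by
    intro t ht
    have hN : ContDiff ℝ (⊤ : ℕ∞) fun p => ‖D1 (D1 F) p‖ ^ 2 := h2.norm_sq ℝ
    have hA := (deriv_integral hN t).const_mul (1/2)
    have : ∀ s, D2 (fun p => ‖D1 (D1 F) p‖ ^ 2) (s, t) =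
        2 * ⟪D1 (D1 F) (s, t), D1 (D1 (D2 F)) (s, t)⟫ := fun s => by
      have ha := (hasD2 h2 s t).norm_sq
      rw [D_comm h1, D_comm hXsm] at ha
      exact (hasD2 hN s t).unique ha
    simp only [this, intervalIntegral.integral_const_mul, hQ t ht] at hA
    refine hA.congr_deriv ?_
    ring
  have hneg : ∀ t, (- ∫ s in (0:ℝ)..1,
      (‖D1 G (s, t)‖ ^ 2 + γ * ⟪D1 F (s, t), D1 G (s, t)⟫ ^ 2)) ≤ 0 := fun t =>
    neg_nonpos.2 (intervalIntegral.integral_nonneg zero_le_one fun s _ => by positivity)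
  refine ⟨fun t ht => ⟨hder t ht, hneg t⟩, ?_⟩
  have hanti : AntitoneOn (fun r => (1/2) * ∫ s in (0:ℝ)..1, ‖D1 (D1 F) (s, r)‖ ^ 2)
      (Icc (0:ℝ) T) := by
    refine antitoneOn_of_deriv_nonpos (convex_Icc 0 T)
      (fun t ht => (hder t ht).continuousAt.continuousWithinAt)
      (fun t ht => (hder t (interior_subset ht)).differentiableAt.differentiableWithinAt)
      (fun t ht => ?_)
    rw [(hder t (interior_subset ht)).deriv]
    exact hneg t
  intro a ha b hb hab
  have := hanti ha hb hab
  simp only at this ⊢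
  linarith
end
end

section
/- For every integer k ≥ 1, the equation cos ξ · cosh ξ = 1 has exactly one solution ξ_k in the interval (kπ, (k+1)π); the resulting sequence (ξ_k)_{k≥1} is strictly increasing, and ξ_k − (2k+1)π/2 → 0 as k → ∞. -/
open Set Real MeasureTheory RealInnerProductSpace

noncomputable section

/-! ### STATEMENT 16 : the frequencies ξ_k -/

/-- the Gudermannian function -/
def gdm (x : ℝ) : ℝ := Real.arctan (Real.sinh x)

lemma gdm_cos (x : ℝ) : Real.cos (gdm x) * Real.cosh x = 1 := by
  have hc := Real.cosh_pos x
  have h : √(1 + Real.sinh x ^ 2) = Real.cosh x := by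
    rw [← Real.sqrt_sq hc.le, Real.cosh_sq, add_comm]
  rw [gdm, Real.cos_arctan, h]
  field_simp

lemma gdm_lt (x : ℝ) : gdm x < π / 2 := Real.arctan_lt_pi_div_two _

lemma gdm_pos {x : ℝ} (hx : 0 < x) : 0 < gdm x := by
  rw [gdm, Real.arctan_pos]
  exact Real.sinh_pos_iff.2 hx

lemma gdm_deriv (x : ℝ) : HasDerivAt gdm (1 / Real.cosh x) x := by
  have h := (Real.hasDerivAt_sinh x).arctan
  have hc := Real.cosh_pos x
  have e : 1 / (1 + Real.sinh x ^ 2) * Real.cosh x = 1 / Real.cosh x := by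
    rw [add_comm, ← Real.cosh_sq]
    field_simp
  rw [e] at h
  exact h

lemma gdm_cont : Continuous gdm :=
  continuous_iff_continuousAt.2 fun x => (gdm_deriv x).continuousAt

lemma phi_mono (e : ℝ) (he : e = 1 ∨ e = -1) :
    StrictMonoOn (fun x => x - e * gdm x) (Ici 0) := by
  apply strictMonoOn_of_deriv_pos (convex_Ici 0)
  · exact (continuous_id.sub (continuous_const.mul gdm_cont)).continuousOn
  · intro x hx
    rw [interior_Ici] at hx
    have hx : 0 < x := hx
    have hd : HasDerivAt (fun x => x - e * gdm x) (1 - e * (1 / Real.cosh x)) x :=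
      (hasDerivAt_id x).sub ((gdm_deriv x).const_mul e)
    rw [hd.deriv]
    have h1 : 1 < Real.cosh x := Real.one_lt_cosh.2 hx.ne'
    have h2 : 1 / Real.cosh x < 1 := by
      rw [div_lt_one (by linarith)]; exact h1
    have h3 : 0 < 1 / Real.cosh x := by positivity
    rcases he with rfl | rfl <;> linarith

lemma key (k : ℕ) (x : ℝ) (hx : x ∈ Ioo ((k : ℝ) * π) (((k : ℝ) + 1) * π)) (hk : 1 ≤ k) :
    Real.cos x * Real.cosh x = 1 ↔
      x - (-1) ^ k * gdm x = (2 * (k : ℝ) + 1) * π / 2 - (-1) ^ k * (π / 2) := by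
  obtain ⟨h1, h2⟩ := hx
  have hk' : (1 : ℝ) ≤ k := by exact_mod_cast hk
  have hp := Real.pi_pos
  have hx0 : 0 < x := by nlinarith
  have hg := gdm_pos hx0
  have hg' := gdm_lt x
  have hc := Real.cosh_pos x
  have hcos := Real.cos_sub_nat_mul_pi x k
  have A : Real.cos x * Real.cosh x = 1 ↔ Real.cos x = Real.cos (gdm x) := by
    rw [← gdm_cos x]
    exact mul_left_inj' hc.ne'
  rw [A]
  have ht : x - k * π ∈ Icc 0 π := ⟨by linarith, by linarith⟩
  rcases neg_one_pow_eq_or ℝ k with he | he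
  · rw [he] at hcos ⊢
    rw [one_mul] at hcos
    rw [← hcos, Real.injOn_cos.eq_iff ht ⟨by linarith, by linarith⟩]
    constructor <;> intro h <;> linarith
  · rw [he] at hcos ⊢
    have B : Real.cos x = Real.cos (gdm x) ↔ Real.cos (x - k * π) = Real.cos (π - gdm x) := by
      rw [hcos, Real.cos_pi_sub]
      constructor <;> intro h <;> linarith
    rw [B, Real.injOn_cos.eq_iff ht ⟨by linarith, by linarith⟩]
    constructor <;> intro h <;> linarith

theorem xi_exists_unique_and_asymptotics :
    (∀ k : ℕ, 1 ≤ k →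
      ∃! x : ℝ, x ∈ Ioo ((k : ℝ) * π) (((k : ℝ) + 1) * π) ∧ Real.cos x * Real.cosh x = 1)
    ∧ ∀ ξ : ℕ → ℝ,
      (∀ k : ℕ, 1 ≤ k → ξ k ∈ Ioo ((k : ℝ) * π) (((k : ℝ) + 1) * π) ∧
        Real.cos (ξ k) * Real.cosh (ξ k) = 1) →
      StrictMonoOn ξ (Ici 1) ∧
      Filter.Tendsto (fun k : ℕ => ξ k - (2 * (k : ℝ) + 1) * π / 2)
        Filter.atTop (nhds 0) := by
  have hp := Real.pi_pos
  refine ⟨fun k hk => ?_, fun ξ hξ => ⟨?_, ?_⟩⟩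
  · have hk' : (1 : ℝ) ≤ k := by exact_mod_cast hk
    have ha : 0 < (k : ℝ) * π := by positivity
    have hb : 0 < ((k : ℝ) + 1) * π := by positivity
    have hga := gdm_pos ha
    have hga' := gdm_lt (k * π)
    have hgb := gdm_pos hb
    have hgb' := gdm_lt ((k + 1) * π)
    have he := neg_one_pow_eq_or ℝ k
    have hI := intermediate_value_Ioo (a := (k : ℝ) * π) (b := ((k : ℝ) + 1) * π)
      (by linarith) (f := fun x => x - (-1) ^ k * gdm x)
      (continuous_id.sub (continuous_const.mul gdm_cont)).continuousOn
    have hm : (2 * (k : ℝ) + 1) * π / 2 - (-1) ^ k * (π / 2) ∈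
        Ioo ((k : ℝ) * π - (-1) ^ k * gdm (k * π))
          (((k : ℝ) + 1) * π - (-1) ^ k * gdm ((k + 1) * π)) := by
      rcases he with he | he <;> rw [he] <;> constructor <;> linarith
    obtain ⟨x, hx, hxe⟩ := hI hm
    refine ⟨x, ⟨hx, (key k x hx hk).2 hxe⟩, ?_⟩
    rintro y ⟨hy, hye⟩
    have hye := (key k y hy hk).1 hye
    exact (phi_mono _ he).injOn (ha.le.trans hy.1.le) (ha.le.trans hx.1.le) (hye.trans hxe.symm)
  · intro i hi j hj hij
    have h1 := (hξ i hi).1.2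
    have h2 := (hξ j hj).1.1
    have h3 : (i : ℝ) + 1 ≤ j := by exact_mod_cast hij
    nlinarith
  · have hlim : Filter.Tendsto ξ Filter.atTop Filter.atTop := by
      refine Filter.tendsto_atTop_mono' _ ?_ (tendsto_natCast_atTop_atTop (R := ℝ))
      filter_upwards [Filter.eventually_ge_atTop 1] with k hk
      have h1 := (hξ k hk).1.1
      have : (0 : ℝ) ≤ k := by positivity
      nlinarith [Real.pi_gt_three]
    have hs : Filter.Tendsto Real.sinh Filter.atTop Filter.atTop := by
      refine Filter.tendsto_atTop_mono' _ ?_ Filter.tendsto_id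
      filter_upwards [Filter.eventually_ge_atTop 0] with x hx
      exact Real.self_le_sinh_iff.2 hx
    have hg : Filter.Tendsto (fun k => π / 2 - gdm (ξ k)) Filter.atTop (nhds 0) := by
      have h := ((Real.tendsto_arctan_atTop.mono_right nhdsWithin_le_nhds).comp
        (hs.comp hlim)).const_sub (π / 2)
      rw [sub_self] at h
      exact h
    refine squeeze_zero_norm' ?_ hg
    filter_upwards [Filter.eventually_ge_atTop 1] with k hk
    have h := (key k _ (hξ k hk).1 hk).1 (hξ k hk).2
    have e : ξ k - (2 * (k : ℝ) + 1) * π / 2 = (-1) ^ k * (gdm (ξ k) - π / 2) := by linarith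
    have hl := gdm_lt (ξ k)
    rw [e, norm_mul, norm_pow, norm_neg, norm_one, one_pow, one_mul, Real.norm_eq_abs,
      abs_of_neg (by linarith)]
    linarith
end
end
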